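/- arXiv:1502.01109 — 2 statements merged into one kernel-verified Lean document; each statement's English description precedes it below -/
import Mathlib

section
/- Let D > 0 be a nonsquare integer and let (x₁, y₁) be the fundamental solution of x² − D y² = 1, i.e., the solution in positive integers with x₁ and y₁ minimal. Call two integer solutions (u, v) and (u′, v′) of u² − D v² = m equivalent if u′ + v′√D = ±(x₁ + y₁√D)^r (u + v√D) for some r ∈ ℤ. Then: if m > 0, every equivalence class of solutions of u² − D v² = m contains exactly one (u, v) with u > 0 and −(y₁/(x₁+1)) u < v ≤ (y₁/(x₁+1)) u; and if m < 0, every equivalence class contains exactly one (u, v) with v > 0 and −(D y₁/(x₁+1)) v < u ≤ (D y₁/(x₁+1)) v. -/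
/-- Two integer solutions `z = u + v√D` and `w = u' + v'√D` of `u² - D v² = m` are
equivalent if `w = ±(x₁ + y₁√D)^r z` for some `r ∈ ℤ`, where `f = x₁ + y₁√D` is the
fundamental solution of `x² - D y² = 1`.  Since `f` is a unit of `ℤ[√D]`, this is
equivalent to `fʳ z = ±w` or `fʳ w = ±z` for some natural number `r`. -/
def PellEquiv (D : ℤ) (f z w : Zsqrtd D) : Prop :=
  ∃ r : ℕ, f ^ r * z = w ∨ f ^ r * z = -w ∨ f ^ r * w = z ∨ f ^ r * w = -z

/-- Equivalence via integer powers of the unit. -/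
def PellRel {D : ℤ} (F : (Zsqrtd D)ˣ) (z w : Zsqrtd D) : Prop :=
  ∃ k : ℤ, w = ((F ^ k : (Zsqrtd D)ˣ) : Zsqrtd D) * z ∨
    w = -(((F ^ k : (Zsqrtd D)ˣ) : Zsqrtd D) * z)

theorem pellEquiv_iff {D : ℤ} (F : (Zsqrtd D)ˣ) (z w : Zsqrtd D) :
    PellEquiv D (F : Zsqrtd D) z w ↔ PellRel F z w := by
  have key : ∀ (r : ℕ) (a b : Zsqrtd D), (F : Zsqrtd D) ^ r * a = b →
      a = ((F ^ (-(r : ℤ)) : (Zsqrtd D)ˣ) : Zsqrtd D) * b := by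
    intro r a b h
    rw [← h, ← mul_assoc, ← Units.val_pow_eq_pow_val, ← Units.val_mul, zpow_neg, zpow_natCast]
    simp
  constructor
  · rintro ⟨r, h | h | h | h⟩
    · exact ⟨r, Or.inl (by rw [← h]; simp)⟩
    · refine ⟨r, Or.inr ?_⟩
      rw [zpow_natCast, Units.val_pow_eq_pow_val, h, neg_neg]
    · exact ⟨-r, Or.inl (key r _ _ h)⟩
    · exact ⟨-r, Or.inr (by rw [key r _ _ h, mul_neg])⟩
  · rintro ⟨k, h⟩
    obtain ⟨r, rfl | rfl⟩ := k.eq_nat_or_neg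
    · refine ⟨r, ?_⟩
      rw [zpow_natCast, Units.val_pow_eq_pow_val] at h
      rcases h with h | h
      · exact Or.inl h.symm
      · exact Or.inr (Or.inl (by rw [h, neg_neg]))
    · refine ⟨r, ?_⟩
      have e : (F : Zsqrtd D) ^ r * ((F ^ (-(r : ℤ)) : (Zsqrtd D)ˣ) : Zsqrtd D) = 1 := by
        rw [← Units.val_pow_eq_pow_val, ← Units.val_mul, zpow_neg, zpow_natCast]
        simp
      rcases h with h | h
      · exact Or.inr (Or.inr (Or.inl (by rw [h, ← mul_assoc, e, one_mul])))
      · exact Or.inr (Or.inr (Or.inr (by rw [h, mul_neg, ← mul_assoc, e, one_mul])))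

theorem PellRel.mul {D : ℤ} {F : (Zsqrtd D)ˣ} {z w : Zsqrtd D} (h : PellRel F z w) (j : ℤ) :
    PellRel F z (((F ^ j : (Zsqrtd D)ˣ) : Zsqrtd D) * w) := by
  obtain ⟨k, h⟩ := h
  refine ⟨j + k, ?_⟩
  rw [zpow_add, Units.val_mul]
  rcases h with h | h
  · left; rw [h, mul_assoc]
  · right; rw [h, mul_neg, mul_assoc]

theorem PellRel.neg {D : ℤ} {F : (Zsqrtd D)ˣ} {z w : Zsqrtd D} (h : PellRel F z w) :
    PellRel F z (-w) := by
  obtain ⟨k, h⟩ := h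
  refine ⟨k, ?_⟩
  rcases h with h | h
  · right; rw [h]
  · left; rw [h, neg_neg]

/-- The fundamental strip. -/
def InStrip {D : ℤ} (x y : ℤ) (w : Zsqrtd D) : Prop :=
  0 < w.re ∧ -(y * w.re) < (x + 1) * w.im ∧ (x + 1) * w.im ≤ y * w.re

theorem strip_step {D : ℤ} (x y : ℤ) (hD : 0 < D) (hx : 0 < x) (hy : 0 < y)
    (hP : x ^ 2 - D * y ^ 2 = 1) (w : Zsqrtd D) (h0 : 0 < w.re)
    (h1 : -(y * w.re) < (x + 1) * w.im) :
    0 < ((⟨x, y⟩ : Zsqrtd D) * w).re ∧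
      y * ((⟨x, y⟩ : Zsqrtd D) * w).re < (x + 1) * ((⟨x, y⟩ : Zsqrtd D) * w).im := by
  simp only [Zsqrtd.re_mul, Zsqrtd.im_mul]
  obtain ⟨u, v⟩ := w
  simp only at *
  constructor
  · have h2 : D * y * (-(y * u)) < D * y * ((x + 1) * v) :=
      mul_lt_mul_of_pos_left h1 (by positivity)
    have h3 : (x + 1) * u < (x + 1) * (x * u + D * y * v) := by
      linear_combination h2 - u * hP
    have := lt_of_mul_lt_mul_left h3 (by linarith)
    linarith
  · linear_combination h1 - v * hP

theorem strip_pow {D : ℤ} (x y : ℤ) (hD : 0 < D) (hx : 0 < x) (hy : 0 < y)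
    (hP : x ^ 2 - D * y ^ 2 = 1) (w : Zsqrtd D) (h0 : 0 < w.re)
    (h1 : -(y * w.re) < (x + 1) * w.im) (n : ℕ) :
    0 < ((⟨x, y⟩ : Zsqrtd D) ^ (n + 1) * w).re ∧
      y * ((⟨x, y⟩ : Zsqrtd D) ^ (n + 1) * w).re <
        (x + 1) * ((⟨x, y⟩ : Zsqrtd D) ^ (n + 1) * w).im := by
  induction n with
  | zero => simpa only [zero_add, pow_one] using strip_step x y hD hx hy hP w h0 h1
  | succ n ih =>
    rw [pow_succ', mul_assoc]
    refine strip_step x y hD hx hy hP _ ih.1 ?_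
    have := mul_pos hy ih.1
    linarith [ih.2]

theorem strip_unique_nat {D : ℤ} (x y : ℤ) (hD : 0 < D) (hx : 0 < x) (hy : 0 < y)
    (hP : x ^ 2 - D * y ^ 2 = 1) (w w' : Zsqrtd D) (h : InStrip x y w) (h' : InStrip x y w')
    (n : ℕ) (e : w' = (⟨x, y⟩ : Zsqrtd D) ^ n * w ∨ w' = -((⟨x, y⟩ : Zsqrtd D) ^ n * w)) :
    w' = w := by
  obtain ⟨a1, a2, a3⟩ := h'
  cases n with
  | zero =>
    rcases e with e | e
    · simpa using e
    · have := h.1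
      rw [e] at a1
      simp at a1
      linarith
  | succ n =>
    obtain ⟨b1, b2⟩ := strip_pow x y hD hx hy hP w h.1 h.2.1 n
    rcases e with e | e
    · rw [← e] at b2
      linarith
    · rw [e, Zsqrtd.re_neg] at a1
      linarith

theorem strip_unique {D : ℤ} (x y : ℤ) (hD : 0 < D) (hx : 0 < x) (hy : 0 < y)
    (hP : x ^ 2 - D * y ^ 2 = 1) (F : (Zsqrtd D)ˣ) (hF : (F : Zsqrtd D) = ⟨x, y⟩)
    (z w w' : Zsqrtd D) (r : PellRel F z w) (r' : PellRel F z w')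
    (h : InStrip x y w) (h' : InStrip x y w') : w' = w := by
  have q : PellRel F w w' := by
    obtain ⟨k, hk⟩ := r
    obtain ⟨l, hl⟩ := r'
    have e : ((F ^ (l - k) : (Zsqrtd D)ˣ) : Zsqrtd D) * ((F ^ k : (Zsqrtd D)ˣ) : Zsqrtd D)
        = ((F ^ l : (Zsqrtd D)ˣ) : Zsqrtd D) := by
      rw [← Units.val_mul, ← zpow_add, sub_add_cancel]
    refine ⟨l - k, ?_⟩
    rcases hk with hk | hk <;> rcases hl with hl | hl <;>
      simp only [hk, hl, mul_neg, ← mul_assoc, e, neg_neg] <;> simp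
  rw [← pellEquiv_iff, hF] at q
  obtain ⟨n, q | q | q | q⟩ := q
  · exact strip_unique_nat x y hD hx hy hP w w' h h' n (Or.inl q.symm)
  · exact strip_unique_nat x y hD hx hy hP w w' h h' n (Or.inr (by rw [q, neg_neg]))
  · exact (strip_unique_nat x y hD hx hy hP w' w h' h n (Or.inl q.symm)).symm
  · exact (strip_unique_nat x y hD hx hy hP w' w h' h n (Or.inr (by rw [q, neg_neg]))).symm

theorem unit_norm {D : ℤ} (x y : ℤ) (hP : x ^ 2 - D * y ^ 2 = 1) (F : (Zsqrtd D)ˣ)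
    (hF : (F : Zsqrtd D) = ⟨x, y⟩) (k : ℤ) : ((F ^ k : (Zsqrtd D)ˣ) : Zsqrtd D).norm = 1 := by
  have hn : (F : Zsqrtd D).norm = 1 := by
    rw [hF, Zsqrtd.norm_def]; simp only; linarith
  have h1 : Units.map (Zsqrtd.normMonoidHom (d := D)) F = 1 := by
    ext; exact hn
  have h2 : Units.map (Zsqrtd.normMonoidHom (d := D)) (F ^ k) = 1 := by
    rw [map_zpow, h1, one_zpow]
  exact congrArg Units.val h2

theorem strip_exists {D : ℤ} (x y : ℤ) (hD : 0 < D) (hx : 0 < x) (hy : 0 < y)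
    (hP : x ^ 2 - D * y ^ 2 = 1) (F : (Zsqrtd D)ˣ) (hF : (F : Zsqrtd D) = ⟨x, y⟩)
    (hFi : ((F⁻¹ : (Zsqrtd D)ˣ) : Zsqrtd D) = ⟨x, -y⟩)
    (z : Zsqrtd D) (hz : 0 < z.norm) : ∃ w, PellRel F z w ∧ InStrip x y w := by
  have hnorm : ∀ w, PellRel F z w → D * w.im ^ 2 < w.re ^ 2 := by
    rintro w ⟨k, hk⟩
    have : w.norm = z.norm := by
      rcases hk with hk | hk
      · rw [hk, Zsqrtd.norm_mul, unit_norm x y hP F hF, one_mul]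
      · rw [hk, Zsqrtd.norm_neg, Zsqrtd.norm_mul, unit_norm x y hP F hF, one_mul]
    rw [← this, Zsqrtd.norm_def] at hz
    linarith
  have hzz : PellRel F z z := ⟨0, Or.inl (by simp)⟩
  have hne : ∃ n : ℕ, ∃ w, PellRel F z w ∧ 0 < w.re ∧ w.re = n := by
    have hz0 : z.re ≠ 0 := by
      intro h0
      have := hnorm z hzz
      rw [h0] at this
      nlinarith [sq_nonneg z.im, mul_nonneg hD.le (sq_nonneg z.im)]
    rcases lt_or_gt_of_ne hz0 with h | h
    · exact ⟨(-z).re.toNat, -z, hzz.neg, by simpa using h, by simp; omega⟩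
    · exact ⟨z.re.toNat, z, hzz, h, by omega⟩
  classical
  obtain ⟨w, hw, hw0, hwn⟩ := Nat.find_spec hne
  have hmin : ∀ w', PellRel F z w' → 0 < w'.re → w.re ≤ w'.re := by
    intro w' hw' h0
    have := Nat.find_min' hne (m := w'.re.toNat) ⟨w', hw', h0, by omega⟩
    omega
  have r1 := hw.mul 1
  have r2 := hw.mul (-1)
  rw [zpow_one, hF] at r1
  rw [zpow_neg_one, hFi] at r2
  have hN := hnorm w hw
  have m1 := hmin _ r1
  have m2 := hmin _ r2
  obtain ⟨u, v⟩ := w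
  simp only [Zsqrtd.re_mul] at *
  have hlt : |D * y * v| < x * u := by
    apply abs_lt_of_sq_lt_sq _ (by positivity)
    have h1 : (D * y ^ 2) * (D * v ^ 2) ≤ (D * y ^ 2) * u ^ 2 :=
      mul_le_mul_of_nonneg_left hN.le (by positivity)
    have h2 : 0 < u ^ 2 := by positivity
    linear_combination h1 + h2 - u ^ 2 * hP
  obtain ⟨hl1, hl2⟩ := abs_lt.1 hlt
  have m1 := m1 (by linarith)
  have m2 := m2 (by linarith)
  have hx1 : 1 < x := by nlinarith [mul_pos hD (pow_pos hy 2)]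
  have c1 : -(y * u) ≤ (x + 1) * v := by
    have : y * u ≤ y * (x * u + D * y * v) := mul_le_mul_of_nonneg_left m1 hy.le
    have : (x - 1) * (-(y * u)) ≤ (x - 1) * ((x + 1) * v) := by
      linear_combination this - v * hP
    exact le_of_mul_le_mul_left this (by linarith)
  have c2 : (x + 1) * v ≤ y * u := by
    have : y * u ≤ y * (x * u + D * (-y) * v) := mul_le_mul_of_nonneg_left m2 hy.le
    have : (x - 1) * ((x + 1) * v) ≤ (x - 1) * (y * u) := by
      linear_combination this + v * hP
    exact le_of_mul_le_mul_left this (by linarith)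
  rcases c1.lt_or_eq with c1 | c1
  · exact ⟨_, hw, hw0, c1, c2⟩
  · refine ⟨_, r1, ?_⟩
    have p := mul_pos hy hw0
    have e1 : x * u + D * y * v = u := by
      have : (x + 1) * (x * u + D * y * v) = (x + 1) * u := by
        linear_combination u * hP - D * y * c1
      exact mul_left_cancel₀ (by linarith) this
    have e2 : x * v + y * u = -v := by linear_combination -c1
    refine ⟨?_, ?_, ?_⟩ <;> simp only [Zsqrtd.re_mul, Zsqrtd.im_mul, e1, e2]
    · exact hw0
    · linarith
    · linarith

/-- Lemma 3 of Andrews–Dyson–Hickerson.  Let `D > 0` be a nonsquare integer and `(x₁, y₁)`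
the fundamental solution of `x² - D y² = 1` (the solution with `x₁, y₁` minimal positive).
If `m > 0`, each equivalence class of solutions of `u² - D v² = m` contains a unique
`(u, v)` with `u > 0` and `-(y₁/(x₁+1)) u < v ≤ (y₁/(x₁+1)) u`; if `m < 0`, each class
contains a unique `(u, v)` with `v > 0` and `-(D y₁/(x₁+1)) v < u ≤ (D y₁/(x₁+1)) v`
(the inequalities are stated multiplied through by `x₁ + 1 > 0`). -/
theorem pell_class_representatives
    (D : ℤ) (hD : 0 < D) (hDnonsq : ¬∃ k : ℤ, k * k = D)
    (x₁ y₁ : ℤ) (hx₁ : 0 < x₁) (hy₁ : 0 < y₁)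
    (hPell : x₁ ^ 2 - D * y₁ ^ 2 = 1)
    (hmin : ∀ x y : ℤ, 0 < x → 0 < y → x ^ 2 - D * y ^ 2 = 1 → x₁ ≤ x ∧ y₁ ≤ y)
    (m : ℤ) (z : Zsqrtd D) (hz : z.norm = m) :
    (0 < m → ∃! w : Zsqrtd D,
      PellEquiv D ⟨x₁, y₁⟩ z w ∧ 0 < w.re ∧
        -(y₁ * w.re) < (x₁ + 1) * w.im ∧ (x₁ + 1) * w.im ≤ y₁ * w.re) ∧
    (m < 0 → ∃! w : Zsqrtd D,
      PellEquiv D ⟨x₁, y₁⟩ z w ∧ 0 < w.im ∧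
        -(D * y₁ * w.im) < (x₁ + 1) * w.re ∧ (x₁ + 1) * w.re ≤ D * y₁ * w.im) := by
  have hmul : (⟨x₁, y₁⟩ : Zsqrtd D) * ⟨x₁, -y₁⟩ = 1 := by
    ext <;> simp <;> linarith
  obtain ⟨F, hF, hFi⟩ : ∃ F : (Zsqrtd D)ˣ, (F : Zsqrtd D) = ⟨x₁, y₁⟩ ∧
      ((F⁻¹ : (Zsqrtd D)ˣ) : Zsqrtd D) = ⟨x₁, -y₁⟩ :=
    ⟨⟨_, _, hmul, by rw [mul_comm]; exact hmul⟩, rfl, rfl⟩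
  rw [← hF]
  simp only [pellEquiv_iff]
  constructor
  · intro hm
    obtain ⟨w, r, h⟩ := strip_exists x₁ y₁ hD hx₁ hy₁ hPell F hF hFi z (by rw [hz]; exact hm)
    refine ⟨w, ⟨r, h⟩, ?_⟩
    rintro w' ⟨r', h'⟩
    exact strip_unique x₁ y₁ hD hx₁ hy₁ hPell F hF z w w' r r' h h'
  · intro hm
    -- multiply by `√D` to reduce to the positive case
    have hs : ∀ a w : Zsqrtd D, PellRel F a w → PellRel F (Zsqrtd.sqrtd * a) (Zsqrtd.sqrtd * w) := by
      rintro a w ⟨k, hk | hk⟩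
      · exact ⟨k, Or.inl (by rw [hk]; ring)⟩
      · exact ⟨k, Or.inr (by rw [hk]; ring)⟩
    have hstrip : ∀ w : Zsqrtd D, InStrip x₁ y₁ (Zsqrtd.sqrtd * w) ↔
        (0 < w.im ∧ -(D * y₁ * w.im) < (x₁ + 1) * w.re ∧ (x₁ + 1) * w.re ≤ D * y₁ * w.im) := by
      intro w
      have e1 : (Zsqrtd.sqrtd * w).re = D * w.im := by simp
      have e2 : (Zsqrtd.sqrtd * w).im = w.re := by simp
      have e3 : y₁ * (D * w.im) = D * y₁ * w.im := by ring
      rw [InStrip, e1, e2, e3, mul_pos_iff_of_pos_left hD]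
    have hinj : ∀ a b : Zsqrtd D, Zsqrtd.sqrtd * a = Zsqrtd.sqrtd * b → a = b := by
      intro a b h
      have h1 := congrArg Zsqrtd.re h
      have h2 := congrArg Zsqrtd.im h
      simp at h1 h2
      ext
      · exact h2
      · exact h1.resolve_right hD.ne'
    simp only [← hstrip]
    obtain ⟨w, r, h⟩ := strip_exists x₁ y₁ hD hx₁ hy₁ hPell F hF hFi (Zsqrtd.sqrtd * z) (by
      rw [Zsqrtd.norm_mul, hz, Zsqrtd.norm_def]
      simp
      nlinarith)
    obtain ⟨w, rfl, r₀⟩ : ∃ w₀, w = Zsqrtd.sqrtd * w₀ ∧ PellRel F z w₀ := by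
      obtain ⟨k, hk | hk⟩ := r
      · exact ⟨_, by rw [hk]; ring, k, Or.inl rfl⟩
      · exact ⟨-(((F ^ k : (Zsqrtd D)ˣ) : Zsqrtd D) * z), by rw [hk]; ring, k, Or.inr rfl⟩
    refine ⟨w, ⟨r₀, h⟩, ?_⟩
    rintro w' ⟨r', h'⟩
    exact hinj _ _ (strip_unique x₁ y₁ hD hx₁ hy₁ hPell F hF _ _ _ (hs _ _ r₀) (hs _ _ r') h h')
end

section
/- (i) The sequences (a_n, b_n) form a Bailey pair relative to 1, where a_{2n} = (1 − q^{4n}) q^{2n²−2n+1} ∑_{j=−n}^{n−1} q^{−2j²}, a_{2n+1} = −(1 − q^{4n+2}) q^{2n²} ∑_{j=−n}^{n} q^{−2j²−2j}, b_0 = 0, and b_n = (−1)^n q^{−n+1} / ((q²;q²)_{n−1} (1 − q^{2n−1})) for n ≥ 1. (ii) The sequences (α_n, β_n) form a Bailey pair relative to q, where α_{2n} = (1/(1−q)) ( q^{2n²} ∑_{j=−n}^{n} q^{−2j²−2j} + q^{2n²+2n+1} ∑_{j=−n}^{n−1} q^{−2j²} ), α_{2n+1} = −(1/(1−q)) ( q^{2n²+2n+1}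 ∑_{j=−n−1}^{n} q^{−2j²} + q^{2n²+4n+2} ∑_{j=−n}^{n} q^{−2j²−2j} ), and β_n = (−1)^n q^{−n} / ((q²;q²)_n (1 − q^{2n+1})). -/
/-- The indeterminate `q` of the field of formal Laurent series `ℚ((q))`. -/
noncomputable def q : LaurentSeries ℚ := HahnSeries.single 1 1

/-- The q-Pochhammer symbol `(a; b)_n = ∏_{j=0}^{n-1} (1 - a * b^j)` in `ℚ((q))`. -/
noncomputable def poch (a b : LaurentSeries ℚ) (n : ℕ) : LaurentSeries ℚ :=
  ∏ j ∈ Finset.range n, (1 - a * b ^ j)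

/-- `(α, β)` is a Bailey pair relative to `a`:
`β_n = ∑_{k=0}^n α_k / ((q)_{n-k} (aq)_{n+k})` for all `n ≥ 0`. -/
def IsBaileyPair (a : LaurentSeries ℚ) (α β : ℕ → LaurentSeries ℚ) : Prop :=
  ∀ n : ℕ, β n =
    ∑ k ∈ Finset.range (n + 1), α k / (poch q q (n - k) * poch (a * q) q (n + k))

/-- `a_{2n} = (1 - q^{4n}) q^{2n²-2n+1} ∑_{j=-n}^{n-1} q^{-2j²}`. -/
noncomputable def aEven (n : ℕ) : LaurentSeries ℚ :=
  (1 - q ^ (4 * n)) * q ^ (2 * n ^ 2 - 2 * n + 1) *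
    ∑ j ∈ Finset.Icc (-(n : ℤ)) ((n : ℤ) - 1), q ^ (-2 * j ^ 2)

/-- `a_{2n+1} = -(1 - q^{4n+2}) q^{2n²} ∑_{j=-n}^{n} q^{-2j²-2j}`. -/
noncomputable def aOdd (n : ℕ) : LaurentSeries ℚ :=
  -((1 - q ^ (4 * n + 2)) * q ^ (2 * n ^ 2) *
    ∑ j ∈ Finset.Icc (-(n : ℤ)) (n : ℤ), q ^ (-2 * j ^ 2 - 2 * j))

/-- The sequence `a` of Proposition 2.1(i). -/
noncomputable def a (m : ℕ) : LaurentSeries ℚ :=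
  if m % 2 = 0 then aEven (m / 2) else aOdd (m / 2)

/-- The sequence `b` of Proposition 2.1(i): `b_0 = 0` and
`b_n = (-1)ⁿ q^{-n+1} / ((q²;q²)_{n-1} (1 - q^{2n-1}))` for `n ≥ 1`. -/
noncomputable def b (n : ℕ) : LaurentSeries ℚ :=
  if n = 0 then 0
  else (-1) ^ n * q ^ (1 - (n : ℤ)) / (poch (q ^ 2) (q ^ 2) (n - 1) * (1 - q ^ (2 * n - 1)))

/-- `α_{2n} = (1/(1-q)) (q^{2n²} ∑_{j=-n}^{n} q^{-2j²-2j} + q^{2n²+2n+1} ∑_{j=-n}^{n-1} q^{-2j²})`. -/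
noncomputable def αEven (n : ℕ) : LaurentSeries ℚ :=
  (q ^ (2 * n ^ 2) * ∑ j ∈ Finset.Icc (-(n : ℤ)) (n : ℤ), q ^ (-2 * j ^ 2 - 2 * j) +
    q ^ (2 * n ^ 2 + 2 * n + 1) * ∑ j ∈ Finset.Icc (-(n : ℤ)) ((n : ℤ) - 1), q ^ (-2 * j ^ 2)) /
      (1 - q)

/-- `α_{2n+1} = -(1/(1-q)) (q^{2n²+2n+1} ∑_{j=-n-1}^{n} q^{-2j²} + q^{2n²+4n+2} ∑_{j=-n}^{n} q^{-2j²-2j})`. -/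
noncomputable def αOdd (n : ℕ) : LaurentSeries ℚ :=
  -((q ^ (2 * n ^ 2 + 2 * n + 1) * ∑ j ∈ Finset.Icc (-(n : ℤ) - 1) (n : ℤ), q ^ (-2 * j ^ 2) +
    q ^ (2 * n ^ 2 + 4 * n + 2) *
      ∑ j ∈ Finset.Icc (-(n : ℤ)) (n : ℤ), q ^ (-2 * j ^ 2 - 2 * j)) / (1 - q))

/-- The sequence `α` of Proposition 2.1(ii). -/
noncomputable def α (m : ℕ) : LaurentSeries ℚ :=
  if m % 2 = 0 then αEven (m / 2) else αOdd (m / 2)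

/-- The sequence `β` of Proposition 2.1(ii):
`β_n = (-1)ⁿ q^{-n} / ((q²;q²)_n (1 - q^{2n+1}))`. -/
noncomputable def β (n : ℕ) : LaurentSeries ℚ :=
  (-1) ^ n * q ^ (-(n : ℤ)) / (poch (q ^ 2) (q ^ 2) n * (1 - q ^ (2 * n + 1)))

/-! Proof: both pairs are governed by a sequence `C` with a two-step recurrence. -/

theorem q_ne : q ≠ 0 := by
  unfold q; exact HahnSeries.single_ne_zero one_ne_zero

theorem q_pow_eq (n : ℕ) : q ^ n = HahnSeries.single (n : ℤ) (1 : ℚ) := by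
  unfold q; simp [HahnSeries.single_pow]

theorem one_sub_ne (n : ℕ) (hn : n ≠ 0) : 1 - q ^ n ≠ 0 := by
  rw [q_pow_eq, sub_ne_zero]
  intro h
  have := congrArg (fun f => HahnSeries.coeff f 0) h
  rw [HahnSeries.coeff_single_of_ne (by exact_mod_cast hn.symm)] at this
  simp at this

theorem poch_q_ne (n : ℕ) : poch q q n ≠ 0 := by
  unfold poch
  refine Finset.prod_ne_zero_iff.2 fun j _ => ?_
  rw [← pow_succ']; exact one_sub_ne _ (by omega)

theorem poch_succ (a b : LaurentSeries ℚ) (n : ℕ) :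
    poch a b (n + 1) = poch a b n * (1 - a * b ^ n) := by
  unfold poch; rw [Finset.prod_range_succ]

theorem poch_qq (n : ℕ) : poch (q * q) q n * (1 - q) = poch q q (n + 1) := by
  unfold poch
  rw [Finset.prod_range_succ']
  simp [pow_succ', mul_assoc]

/-- `1/(q)_m`, zero for negative `m`. -/
noncomputable def iQ (m : ℤ) : LaurentSeries ℚ :=
  if m < 0 then 0 else 1 / poch q q m.toNat

theorem iQ_nat (m : ℕ) : iQ m = 1 / poch q q m := by
  unfold iQ; rw [if_neg (by omega)]; simp

theorem iQ_neg (m : ℤ) (h : m < 0) : iQ m = 0 := by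
  unfold iQ; rw [if_pos h]

theorem iQ_pred (m m' : ℤ) (h : m' = m - 1) : iQ m' = iQ m * (1 - q ^ m) := by
  subst h
  rcases lt_trichotomy m 0 with h | h | h
  · rw [iQ_neg _ h, iQ_neg _ (by omega), zero_mul]
  · subst h; rw [iQ_neg _ (by omega)]; simp
  · obtain ⟨k, rfl⟩ : ∃ k : ℕ, m = (k + 1 : ℕ) := ⟨(m - 1).toNat, by omega⟩
    have : ((k + 1 : ℕ) : ℤ) - 1 = k := by push_cast; ring
    rw [this, iQ_nat, iQ_nat, poch_succ, zpow_natCast, ← pow_succ']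
    have h1 := poch_q_ne k
    have h2 := one_sub_ne (k + 1) (by omega)
    field_simp

/-- The auxiliary sequence. -/
noncomputable def C : ℕ → LaurentSeries ℚ
  | 0 => 0
  | 1 => 1
  | (m + 2) => q ^ (2 * m) * C m + (-1) ^ (m + 1) * ((q ^ (m + 1))⁻¹ + q ^ (m + 1))

noncomputable def TT (n : ℕ) : LaurentSeries ℚ :=
  ∑ j ∈ Finset.Icc (-(n : ℤ)) (n : ℤ), q ^ (-2 * j ^ 2 - 2 * j)

noncomputable def SS (n : ℕ) : LaurentSeries ℚ :=
  ∑ j ∈ Finset.Icc (-(n : ℤ)) ((n : ℤ) - 1), q ^ (-2 * j ^ 2)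

theorem sum_Icc_ext (f : ℤ → LaurentSeries ℚ) (a b : ℤ) (h : a ≤ b + 1) :
    ∑ j ∈ Finset.Icc (a - 1) (b + 1), f j
      = ∑ j ∈ Finset.Icc a b, f j + f (a - 1) + f (b + 1) := by
  have : Finset.Icc (a - 1) (b + 1) = insert (a - 1) (insert (b + 1) (Finset.Icc a b)) := by
    ext x; simp only [Finset.mem_Icc, Finset.mem_insert]; omega
  rw [this, Finset.sum_insert, Finset.sum_insert]
  · ring
  · simp
  · simp only [Finset.mem_Icc, Finset.mem_insert]; omega

theorem TT_succ (n : ℕ) : TT (n + 1) = TT n + q ^ (-2 * (n : ℤ) ^ 2 - 2 * n)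
    + q ^ (-2 * (n : ℤ) ^ 2 - 6 * n - 4) := by
  unfold TT
  have := sum_Icc_ext (fun j => q ^ (-2 * j ^ 2 - 2 * j)) (-(n : ℤ)) n (by omega)
  have e : (-((n + 1 : ℕ) : ℤ)) = -(n : ℤ) - 1 := by push_cast; ring
  have e' : (((n + 1 : ℕ) : ℤ)) = (n : ℤ) + 1 := by push_cast; ring
  rw [e, e', this]
  rw [show -2 * (-(n : ℤ) - 1) ^ 2 - 2 * (-(n : ℤ) - 1) = -2 * (n : ℤ) ^ 2 - 2 * n by ring,
    show -2 * ((n : ℤ) + 1) ^ 2 - 2 * ((n : ℤ) + 1) = -2 * (n : ℤ) ^ 2 - 6 * n - 4 by ring]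

theorem SS_succ (n : ℕ) : SS (n + 1) = SS n + q ^ (-2 * (n : ℤ) ^ 2 - 4 * n - 2)
    + q ^ (-2 * (n : ℤ) ^ 2) := by
  unfold SS
  have := sum_Icc_ext (fun j => q ^ (-2 * j ^ 2)) (-(n : ℤ)) (n - 1) (by omega)
  have e : (-((n + 1 : ℕ) : ℤ)) = -(n : ℤ) - 1 := by push_cast; ring
  have e' : (((n + 1 : ℕ) : ℤ)) - 1 = (n : ℤ) - 1 + 1 := by push_cast; ring
  rw [e, e', this]
  congr 2
  · congr 2; ring
  · ring

theorem C_odd (n : ℕ) : C (2 * n + 1) = q ^ (2 * n ^ 2) * TT n := by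
  induction n with
  | zero => simp [C, TT]
  | succ n ih =>
    have : 2 * (n + 1) + 1 = (2 * n + 1) + 2 := by ring
    rw [this, C, ih, TT_succ]
    have hq := q_ne
    have e1 : ((-1 : LaurentSeries ℚ)) ^ (2 * n + 1 + 1) = 1 := Even.neg_one_pow ⟨n + 1, by ring⟩
    have f0 : q ^ (2 * (n + 1) ^ 2) = q ^ (2 * (2 * n + 1)) * q ^ (2 * n ^ 2) := by
      rw [← pow_add]; congr 1; ring
    have f1 : q ^ (2 * (n + 1) ^ 2) * q ^ (-2 * (n : ℤ) ^ 2 - 2 * n) = q ^ (2 * n + 1 + 1) := by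
      rw [← zpow_natCast, ← zpow_natCast, ← zpow_add₀ hq]; congr 1; push_cast; ring
    have f2 : q ^ (2 * (n + 1) ^ 2) * q ^ (-2 * (n : ℤ) ^ 2 - 6 * n - 4)
        = (q ^ (2 * n + 1 + 1))⁻¹ := by
      rw [← zpow_natCast, ← zpow_natCast, ← zpow_add₀ hq, ← zpow_neg]; congr 1; push_cast; ring
    rw [e1]
    linear_combination - TT n * f0 - f1 - f2

theorem C_even (n : ℕ) : C (2 * n) = -(q ^ (2 * n ^ 2 - 2 * n + 1) * SS n) := by
  have hle : ∀ n : ℕ, 2 * n ≤ 2 * n ^ 2 := fun n => by nlinarith [Nat.le_self_pow two_ne_zero n]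
  induction n with
  | zero => simp [C, SS]
  | succ n ih =>
    have : 2 * (n + 1) = (2 * n) + 2 := by ring
    rw [this, C, ih, SS_succ, ← this]
    have hq := q_ne
    have e1 : ((-1 : LaurentSeries ℚ)) ^ (2 * n + 1) = -1 := Odd.neg_one_pow ⟨n, by ring⟩
    have g : 2 * (n + 1) ^ 2 - 2 * (n + 1) + 1 = 2 * n ^ 2 + 2 * n + 1 := by
      have : 2 * (n + 1) ^ 2 = 2 * n ^ 2 + 2 * n + 2 * (n + 1) := by ring
      omega
    have f0 : q ^ (2 * n ^ 2 + 2 * n + 1) = q ^ (2 * (2 * n)) * q ^ (2 * n ^ 2 - 2 * n + 1) := by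
      rw [← pow_add]; congr 1; have := hle n; omega
    have f1 : q ^ (2 * n ^ 2 + 2 * n + 1) * q ^ (-2 * (n : ℤ) ^ 2) = q ^ (2 * n + 1) := by
      rw [← zpow_natCast, ← zpow_natCast, ← zpow_add₀ hq]; congr 1; push_cast; ring
    have f2 : q ^ (2 * n ^ 2 + 2 * n + 1) * q ^ (-2 * (n : ℤ) ^ 2 - 4 * n - 2)
        = (q ^ (2 * n + 1))⁻¹ := by
      rw [← zpow_natCast, ← zpow_natCast, ← zpow_add₀ hq, ← zpow_neg]; congr 1; push_cast; ring
    rw [e1, g]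
    linear_combination SS n * f0 + f1 + f2

theorem a_eq (m : ℕ) : a m = -((1 - q ^ (2 * m)) * C m) := by
  rcases Nat.even_or_odd' m with ⟨n, rfl | rfl⟩
  · have h1 : 2 * n % 2 = 0 := by omega
    have h2 : 2 * n / 2 = n := by omega
    rw [a, if_pos h1, h2, C_even, aEven, ← SS]
    ring_nf
  · have h1 : ¬ (2 * n + 1) % 2 = 0 := by omega
    have h2 : (2 * n + 1) / 2 = n := by omega
    rw [a, if_neg h1, h2, C_odd, aOdd, ← TT]
    ring_nf

theorem α_eq (m : ℕ) : α m = (C (m + 1) - q ^ (2 * m) * C m) / (1 - q) := by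
  have hle : ∀ n : ℕ, 2 * n ≤ 2 * n ^ 2 := fun n => by nlinarith [Nat.le_self_pow two_ne_zero n]
  rcases Nat.even_or_odd' m with ⟨n, rfl | rfl⟩
  · have h1 : 2 * n % 2 = 0 := by omega
    have h2 : 2 * n / 2 = n := by omega
    rw [α, if_pos h1, h2, C_even, C_odd, αEven, ← SS, ← TT]
    have e : 2 * n ^ 2 + 2 * n + 1 = 2 * (2 * n) + (2 * n ^ 2 - 2 * n + 1) := by
      have := hle n; omega
    rw [e, pow_add q (2 * (2 * n))]
    ring
  · have h1 : ¬ (2 * n + 1) % 2 = 0 := by omega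
    have h2 : (2 * n + 1) / 2 = n := by omega
    have h3 : 2 * n + 1 + 1 = 2 * (n + 1) := by ring
    have h4 : 2 * (n + 1) ^ 2 - 2 * (n + 1) + 1 = 2 * n ^ 2 + 2 * n + 1 := by
      have : 2 * (n + 1) ^ 2 = 2 * n ^ 2 + 2 * n + 2 * (n + 1) := by ring
      omega
    have h5 : ∑ j ∈ Finset.Icc (-(n : ℤ) - 1) (n : ℤ), q ^ (-2 * j ^ 2) = SS (n + 1) := by
      unfold SS
      have e : (-((n + 1 : ℕ) : ℤ)) = -(n : ℤ) - 1 := by push_cast; ring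
      have e' : (((n + 1 : ℕ) : ℤ)) - 1 = (n : ℤ) := by push_cast; ring
      rw [e, e']
    rw [α, if_neg h1, h2, h3, C_even, C_odd, αOdd, ← TT, h4, h5]
    ring

/-- Common value of the sums. -/
noncomputable def Bs (n M : ℕ) : LaurentSeries ℚ :=
  ∑ k ∈ Finset.range M, C (k + 1) * (1 - q ^ (2 * k + 2)) * (iQ (n - k) * iQ (n + k + 2))

theorem zp (i j : ℤ) : q ^ (i + j) = q ^ i * q ^ j := zpow_add₀ q_ne i j
theorem zm (i j : ℤ) : q ^ (i - j) = q ^ i / q ^ j := zpow_sub₀ q_ne i j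

theorem abel_sum (n : ℕ) :
    ∑ k ∈ Finset.range (n + 1), (C (k + 1) - q ^ (2 * k) * C k) * (iQ (n - k) * iQ (n + k + 1))
      = Bs n (n + 1) := by
  unfold Bs
  rw [← sub_eq_zero, ← Finset.sum_sub_distrib]
  have key := Finset.sum_range_sub
    (fun k : ℕ => q ^ (2 * k) * C k * (iQ (n - k) * iQ (n + k + 1))) (n + 1)
  have z : iQ ((n : ℤ) - (n + 1 : ℕ)) = 0 := iQ_neg _ (by push_cast; omega)
  have c0 : C 0 = 0 := by simp [C]
  rw [z, c0] at key
  rw [mul_zero, zero_mul, zero_mul, mul_zero, sub_zero] at key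
  rw [← key]
  refine Finset.sum_congr rfl fun k _ => ?_
  rw [iQ_pred ((n : ℤ) - k) (n - (k + 1 : ℕ)) (by push_cast; ring),
    iQ_pred ((n : ℤ) + k + 2) (n + k + 1) (by ring),
    show (n : ℤ) + (k + 1 : ℕ) + 1 = n + k + 2 by push_cast; ring]
  have hq := q_ne
  have hk := pow_ne_zero k hq
  simp only [zp, zm, zpow_natCast, zpow_ofNat]
  rw [show 2 * k + 2 = k + k + 1 + 1 by ring, show 2 * (k + 1) = k + k + 1 + 1 by ring,
    show 2 * k = k + k by ring]
  simp only [pow_add, pow_one]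
  field_simp
  ring

/-- First certificate. -/
noncomputable def hh (n : ℕ) (k : ℤ) : LaurentSeries ℚ :=
  (1 - q ^ (2 * n) + (1 + q ^ (2 * n)) / q - q ^ n / q * (q ^ k + (q ^ k)⁻¹))
    * (iQ (n - k) * iQ (n + k))

/-- Second certificate. -/
noncomputable def GG (n : ℕ) (k : ℕ) : LaurentSeries ℚ :=
  (-1) ^ k * (q ^ n * (1 / q - 1) - q ^ k / q - (q ^ k)⁻¹) * (iQ (n - k) * iQ (n + k - 1))

theorem GG_step (n k : ℕ) :
    (-1) ^ k * ((q ^ k)⁻¹ + q ^ k) * hh n k = GG n (k + 1) - GG n k := by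
  unfold hh GG
  rw [iQ_pred ((n : ℤ) - k) (n - (k + 1 : ℕ)) (by push_cast; ring),
    iQ_pred ((n : ℤ) + k) (n + k - 1) (by ring),
    show (n : ℤ) + (k + 1 : ℕ) - 1 = n + k by push_cast; ring]
  have hq := q_ne
  have hk := pow_ne_zero k hq
  simp only [zp, zm, zpow_natCast]
  rw [show 2 * n = n + n by ring]
  simp only [pow_add, pow_one]
  field_simp
  ring

theorem hh_zero (n : ℕ) : hh n 0 = GG n 1 := by
  unfold hh GG
  rw [iQ_pred ((n : ℤ)) (n - (1 : ℕ)) (by push_cast; ring),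
    show (n : ℤ) + (1 : ℕ) - 1 = n by push_cast; ring]
  have hq := q_ne
  simp only [zpow_natCast, zpow_zero, sub_zero, add_zero]
  rw [show 2 * n = n + n by ring]
  simp only [pow_add, pow_one]
  field_simp
  ring

theorem hh_rec (n k : ℕ) :
    (1 - q ^ (2 * n)) * (1 - q ^ (2 * n + 1)) *
      ((1 - q ^ (2 * k + 2)) * (iQ (n - k) * iQ (n + k + 2))) +
    q⁻¹ * (1 - q ^ (2 * n) / q) *
      ((1 - q ^ (2 * k + 2)) * (iQ (n - k - 1) * iQ (n + k + 1)))
      = hh n k - q ^ (2 * k + 2) * hh n (k + 2) := by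
  unfold hh
  rw [iQ_pred ((n : ℤ) - k - 1) (n - (k + 2)) (by ring),
    iQ_pred ((n : ℤ) - k) (n - k - 1) (by ring),
    show (n : ℤ) + (k + 2) = n + k + 2 by ring,
    iQ_pred ((n : ℤ) + k + 1) (n + k) (by ring),
    iQ_pred ((n : ℤ) + k + 2) (n + k + 1) (by ring)]
  have hq := q_ne
  have hk := pow_ne_zero k hq
  simp only [zp, zm, zpow_natCast, zpow_one, zpow_ofNat]
  rw [show 2 * n = n + n by ring, show 2 * k = k + k by ring]
  simp only [pow_add, pow_one]
  field_simp
  ring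

theorem partial_sum (n M : ℕ) :
    ∑ k ∈ Finset.range (M + 1), C (k + 1) * (hh n k - q ^ (2 * k + 2) * hh n (k + 2))
      = GG n (M + 1) - q ^ (2 * M) * C M * hh n (M + 1)
        - q ^ (2 * M + 2) * C (M + 1) * hh n (M + 2) := by
  induction M with
  | zero => simp [C, hh_zero]
  | succ M ih =>
    rw [Finset.sum_range_succ, ih]
    have h := GG_step n (M + 1)
    rw [show M + 1 + 1 = M + 2 by ring, C]
    push_cast at h ⊢
    rw [show (M : ℤ) + 1 + 1 = M + 2 by ring]
    rw [show M + 1 + 1 = M + 2 by ring] at h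
    rw [show 2 * (M + 1) = 2 * M + 2 by ring]
    linear_combination h

theorem Bs_rec (n : ℕ) :
    (1 - q ^ (2 * (n + 1))) * (1 - q ^ (2 * (n + 1) + 1)) * Bs (n + 1) (n + 2)
      + q⁻¹ * (1 - q ^ (2 * (n + 1)) / q) * Bs n (n + 1) = 0 := by
  have e : Bs n (n + 1) = Bs n (n + 2) := by
    unfold Bs
    rw [Finset.sum_range_succ _ (n + 1), iQ_neg ((n : ℤ) - (n + 1 : ℕ)) (by push_cast; omega)]
    ring
  have p := partial_sum (n + 1) (n + 1)
  have z1 : GG (n + 1) (n + 1 + 1) = 0 := by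
    unfold GG; rw [iQ_neg (((n + 1 : ℕ) : ℤ) - (n + 1 + 1 : ℕ)) (by push_cast; omega)]; ring
  have z2 : hh (n + 1) ((n + 1 : ℕ) + 1) = 0 := by
    unfold hh; rw [iQ_neg (((n + 1 : ℕ) : ℤ) - ((n + 1 : ℕ) + 1)) (by omega)]; ring
  have z3 : hh (n + 1) ((n + 1 : ℕ) + 2) = 0 := by
    unfold hh; rw [iQ_neg (((n + 1 : ℕ) : ℤ) - ((n + 1 : ℕ) + 2)) (by omega)]; ring
  rw [z1, z2, z3, mul_zero, mul_zero, sub_zero, sub_zero] at p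
  rw [e, ← p]
  unfold Bs
  rw [Finset.mul_sum, Finset.mul_sum, ← Finset.sum_add_distrib]
  refine Finset.sum_congr rfl fun k _ => ?_
  rw [← hh_rec]
  rw [show ((n + 1 : ℕ) : ℤ) - k - 1 = n - k by push_cast; ring,
    show ((n + 1 : ℕ) : ℤ) + k + 1 = n + k + 2 by push_cast; ring]
  ring

theorem Bs_eq (n : ℕ) : Bs n (n + 1) = β n := by
  induction n with
  | zero =>
    have h1 := one_sub_ne 1 (by omega)
    have h2 := one_sub_ne 2 (by omega)
    rw [pow_one] at h1
    have e := iQ_nat 2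
    have e0 := iQ_nat 0
    push_cast at e e0
    simp only [Bs, β, C, zero_add, Finset.sum_range_one, Nat.cast_zero, sub_zero, e, e0]
    simp only [poch, Finset.prod_range_succ, Finset.prod_range_zero]
    simp
    rw [← pow_two]
    field_simp
  | succ n ih =>
    have r := Bs_rec n
    rw [ih] at r
    have h1 := one_sub_ne (2 * (n + 1)) (by omega)
    have h2 := one_sub_ne (2 * (n + 1) + 1) (by omega)
    have h3 := one_sub_ne (2 * n + 1) (by omega)
    have hq := q_ne
    have hp : poch (q ^ 2) (q ^ 2) n ≠ 0 := by
      unfold poch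
      refine Finset.prod_ne_zero_iff.2 fun j _ => ?_
      rw [← pow_succ', ← pow_mul]; exact one_sub_ne _ (by omega)
    have hb : (1 - q ^ (2 * (n + 1))) * (1 - q ^ (2 * (n + 1) + 1)) * β (n + 1)
      + q⁻¹ * (1 - q ^ (2 * (n + 1)) / q) * β n = 0 := by
      unfold β
      rw [poch_succ, ← pow_succ', ← pow_mul,
        show q ^ (2 * (n + 1)) / q = q ^ (2 * n + 1) by
          rw [show 2 * (n + 1) = 2 * n + 1 + 1 by ring, pow_succ q (2 * n + 1)]; field_simp]
      have : q ^ (-((n + 1 : ℕ) : ℤ)) = q ^ (-(n : ℤ)) * q⁻¹ := by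
        push_cast; rw [neg_add, zp, zpow_neg_one]
      rw [this, pow_succ (-1 : LaurentSeries ℚ)]
      field_simp
      ring
    have := mul_ne_zero h1 h2
    apply mul_left_cancel₀ this
    linear_combination r - hb

theorem part_two : IsBaileyPair q α β := by
  intro n
  rw [← Bs_eq, ← abel_sum]
  refine Finset.sum_congr rfl fun k hk => ?_
  have hk' : k ≤ n := by simpa [Nat.lt_succ_iff] using hk
  have e1 := iQ_nat (n - k)
  have e2 := iQ_nat (n + k + 1)
  push_cast [hk'] at e1 e2
  have h1 := one_sub_ne 1 (by omega)
  rw [pow_one] at h1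
  have h2 := poch_q_ne (n - k)
  have h3 := poch_q_ne (n + k + 1)
  rw [e1, e2, α_eq, ← poch_qq]
  rw [← poch_qq] at h3
  have h4 := left_ne_zero_of_mul h3
  field_simp

theorem part_one : IsBaileyPair 1 a b := by
  intro n
  rcases n with _ | n
  · simp [b, a_eq]
  have hb : b (n + 1) = - β n := by
    unfold b β
    rw [if_neg (by omega)]
    rw [show (1 : ℤ) - (n + 1 : ℕ) = -n by push_cast; ring, show n + 1 - 1 = n by omega,
      show 2 * (n + 1) - 1 = 2 * n + 1 by omega, pow_succ]
    ring
  rw [hb, ← Bs_eq, Finset.sum_range_succ', Bs, ← Finset.sum_neg_distrib]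
  have c0 : a 0 = 0 := by simp [a_eq]
  rw [c0, zero_div, add_zero]
  refine Finset.sum_congr rfl fun k hk => ?_
  have hk' : k ≤ n := by simpa [Nat.lt_succ_iff] using hk
  have e1 := iQ_nat (n - k)
  have e2 := iQ_nat (n + k + 2)
  push_cast [hk'] at e1 e2
  rw [e1, e2, a_eq, one_mul, show n + 1 - (k + 1) = n - k by omega,
    show n + 1 + (k + 1) = n + k + 2 by ring, show 2 * (k + 1) = 2 * k + 2 by ring]
  have h2 := poch_q_ne (n - k)
  have h3 := poch_q_ne (n + k + 2)
  field_simp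

/-- Proposition 2.1: `(a, b)` is a Bailey pair relative to `1` and `(α, β)` is a Bailey
pair relative to `q`. -/
theorem bailey_pairs_prop1 : IsBaileyPair 1 a b ∧ IsBaileyPair q α β := by
  exact ⟨part_one, part_two⟩
end
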